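/- Assume p = 0, χ₀ = λ ∈ (1/2)ℤ with λ > 1/2, and χ_j = 0 for all j < 0, so that G(m) = (λ − m − 1/2)Φ(m) for all m ∈ (1/2)ℤ. Then the smallest G-invariant subspace of F containing the vector e_{λ−1/2} = Φ(−λ+1/2)𝟙 has no G-invariant subspaces other than {0} and itself (it is an irreducible submodule of F(λ/z)). -/

import Mathlib

/-!
Common setup (following Adamović–Jing–Misra, "On principal realization of modules for
the affine Lie algebra A₁⁽¹⁾ at the critical level").

Half-integers `(1/2)ℤ` are encoded by doubling: an integer `n : ℤ` stands for the
half-integer `n/2`.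
-/

noncomputable section

/-- Positive half-integers (doubled encoding): `n : ℤ` with `0 < n` stands for `n/2`. -/
abbrev HalfPos : Type := {n : ℤ // 0 < n}

/-- The fermionic space `F = ⋀ V`, where `V` has basis `{e_r : r ∈ (1/2)ℤ, r > 0}`;
`F` is presented through its monomial basis, indexed by finite sets of positive
half-integers. -/
abbrev FSpace : Type := Finset HalfPos →₀ ℂ

/-- The basis monomial `e_{r₁} ∧ ⋯ ∧ e_{r_k}` (`r₁ < ⋯ < r_k` being the elements of `s`). -/
def bVec (s : Finset HalfPos) : FSpace := Finsupp.single s 1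

/-- The vacuum vector `𝟙`. -/
def vacuum : FSpace := bVec ∅

/-- The vector `e_r`. -/
def eVec (r : HalfPos) : FSpace := bVec {r}

/-- `Φ(-r)` for `r > 0`: left exterior multiplication by `e_r`. -/
def phiCreate (r : HalfPos) : FSpace →ₗ[ℂ] FSpace :=
  Finsupp.linearCombination ℂ fun s : Finset HalfPos =>
    if r ∈ s then 0
    else ((-1 : ℂ) ^ (s.filter fun t => t < r).card) • bVec (insert r s)

/-- `Φ(r)` for `r > 0`: the odd derivation of `⋀ V` with `Φ(r) e_s = -(-1)^{2r} δ_{r,s} 𝟙`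
(`(-1)^{2r} = (-1)^m` for the doubled index `m = 2r`). -/
def phiAnnih (r : HalfPos) : FSpace →ₗ[ℂ] FSpace :=
  Finsupp.linearCombination ℂ fun s : Finset HalfPos =>
    if r ∈ s then
      ((-(-1 : ℂ) ^ r.1) * (-1 : ℂ) ^ (s.filter fun t => t < r).card) • bVec (s.erase r)
    else 0

/-- `Φ(m)`, `m ∈ (1/2)ℤ` (doubled index `m : ℤ`); `Φ(0) = ε c · Id`. -/
def Phi (ε c : ℂ) (m : ℤ) : FSpace →ₗ[ℂ] FSpace :=
  if h : 0 < m then phiAnnih ⟨m, h⟩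
  else if h' : m < 0 then phiCreate ⟨-m, by omega⟩
  else (ε * c) • LinearMap.id

/-- `G(m) = (-m - 1/2) Φ(m) + Σ_{j ≤ p} χ_j Φ(m-j)` (a locally finite sum): on a basis
monomial `bVec s` only the finitely many indices `j` belonging to
`Finset.Icc m p ∪ (s.image fun t => m - t.1).filter (· ≤ p)` contribute (for any other
`j ≤ p` one has `Φ(m-j) (bVec s) = 0`), and the operator is defined by its values on
this basis.  (All indices are doubled: `m` stands for `m/2`, and `χ j` for `χ_{j/2}`.) -/
def Gop (ε c : ℂ) (p : ℤ) (χ : ℤ → ℂ) (m : ℤ) : FSpace →ₗ[ℂ] FSpace :=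
  Finsupp.linearCombination ℂ fun s : Finset HalfPos =>
    (-((m : ℂ) + 1) / 2) • Phi ε c m (bVec s) +
      ∑ j ∈ Finset.Icc m p ∪ (s.image fun t => m - t.1).filter (· ≤ p),
        χ j • Phi ε c (m - j) (bVec s)

/-- A subspace `W ⊆ F` is `G`-invariant if `G(m) W ⊆ W` for all `m ∈ (1/2)ℤ`. -/
def GInvariant (ε c : ℂ) (p : ℤ) (χ : ℤ → ℂ) (W : Submodule ℂ FSpace) : Prop :=
  ∀ m : ℤ, ∀ v ∈ W, Gop ε c p χ m v ∈ W

/-- `F(χ)` is irreducible: its only `G`-invariant subspaces are `{0}` and `F`. -/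
def FIrreducible (ε c : ℂ) (p : ℤ) (χ : ℤ → ℂ) : Prop :=
  ∀ W : Submodule ℂ FSpace, GInvariant ε c p χ W → W = ⊥ ∨ W = ⊤

/-- The smallest `G`-invariant subspace of `F` containing a vector `v`. -/
def genSub (ε c : ℂ) (p : ℤ) (χ : ℤ → ℂ) (v : FSpace) : Submodule ℂ FSpace :=
  sInf {W : Submodule ℂ FSpace | GInvariant ε c p χ W ∧ v ∈ W}

theorem phiAnnih_apply (r : HalfPos) (v : FSpace) (t : Finset HalfPos) :
    phiAnnih r v t = if r ∈ t then 0 else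
      ((-(-1 : ℂ) ^ r.1) * (-1 : ℂ) ^ ((insert r t).filter fun u => u < r).card) *
        v (insert r t) := by
  induction v using Finsupp.induction_linear with
  | zero => simp
  | add f g hf hg =>
    rw [map_add, Finsupp.add_apply, hf, hg, Finsupp.add_apply]
    split_ifs <;> ring
  | single s a =>
    rw [phiAnnih, Finsupp.linearCombination_single]
    by_cases hrs : r ∈ s
    · rw [if_pos hrs]
      by_cases hrt : r ∈ t
      · have hne : s.erase r ≠ t := by
          rintro rfl
          simp at hrt
        simp [bVec, hrt, hne]
      · by_cases hst : s = insert r t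
        · subst hst
          rw [if_neg hrt, Finset.erase_insert hrt]
          simp [bVec]
          ring
        · have hne : s.erase r ≠ t := by
            rintro rfl
            exact hst (Finset.insert_erase hrs).symm
          simp [bVec, hrt, hne, hst]
    · have hne : s ≠ insert r t := by
        rintro rfl
        simp at hrs
      simp [hrs, hne]

/-- The span of the monomials divisible by `e_r`. -/
def divisibleBy (r : HalfPos) : Submodule ℂ FSpace :=
  Finsupp.supported ℂ ℂ {s : Finset HalfPos | r ∈ s}

theorem mem_divisibleBy {r : HalfPos} {v : FSpace} :
    v ∈ divisibleBy r ↔ ∀ s, v s ≠ 0 → r ∈ s := by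
  simp [divisibleBy, Finsupp.mem_supported, Set.subset_def]

theorem bVec_mem_divisibleBy {r : HalfPos} {s : Finset HalfPos} (h : r ∈ s) :
    bVec s ∈ divisibleBy r :=
  Finsupp.single_mem_supported ℂ 1 h

theorem phiCreate_mem_divisibleBy {r : HalfPos} (q : HalfPos) {v : FSpace}
    (hv : v ∈ divisibleBy r) : phiCreate q v ∈ divisibleBy r := by
  rw [phiCreate, Finsupp.linearCombination_apply]
  refine Submodule.sum_mem _ fun s hs => Submodule.smul_mem _ _ ?_
  have hrs : r ∈ s := mem_divisibleBy.1 hv s (Finsupp.mem_support_iff.1 hs)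
  split_ifs
  · exact Submodule.zero_mem _
  · exact Submodule.smul_mem _ _ (bVec_mem_divisibleBy (Finset.mem_insert_of_mem hrs))

theorem phiAnnih_mem_divisibleBy {r q : HalfPos} (hqr : q ≠ r) {v : FSpace}
    (hv : v ∈ divisibleBy r) : phiAnnih q v ∈ divisibleBy r := by
  rw [phiAnnih, Finsupp.linearCombination_apply]
  refine Submodule.sum_mem _ fun s hs => Submodule.smul_mem _ _ ?_
  have hrs : r ∈ s := mem_divisibleBy.1 hv s (Finsupp.mem_support_iff.1 hs)
  split_ifs
  · exact Submodule.smul_mem _ _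
      (bVec_mem_divisibleBy (Finset.mem_erase.2 ⟨hqr.symm, hrs⟩))
  · exact Submodule.zero_mem _

theorem Gop_eq_smul_Phi (ε c : ℂ) {χ : ℤ → ℂ} (hχ : ∀ j : ℤ, j < 0 → χ j = 0) (m : ℤ) :
    Gop ε c 0 χ m = (χ 0 - ((m : ℂ) + 1) / 2) • Phi ε c m := by
  refine Finsupp.lhom_ext' fun s => LinearMap.ext_ring ?_
  have hsum : ∑ j ∈ Finset.Icc m 0 ∪ (s.image fun t => m - t.1).filter (· ≤ 0),
      χ j • Phi ε c (m - j) (bVec s) = χ 0 • Phi ε c m (bVec s) := by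
    rw [Finset.sum_eq_single 0]
    · simp
    · intro j hj hj0
      have hj' : j ≤ 0 := by
        simp only [Finset.mem_union, Finset.mem_Icc, Finset.mem_filter] at hj
        omega
      rw [hχ j (by omega), zero_smul]
    · intro h0
      simp only [Finset.mem_union, Finset.mem_Icc, Finset.mem_filter, Finset.mem_image,
        le_refl, and_true, not_or, not_le, not_exists, not_and] at h0
      have hns : (⟨m, h0.1⟩ : HalfPos) ∉ s := fun h => h0.2 _ h (sub_self m)
      simp [Phi, h0.1, phiAnnih, bVec, hns]
  simp only [LinearMap.comp_apply, Finsupp.lsingle_apply, Gop, LinearMap.smul_apply,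
    Finsupp.linearCombination_single, one_smul, hsum]
  rw [← bVec, ← add_smul]
  congr 1
  ring

/-- A `Φ(q)`-stable (`q > 0`, `q ≠ r`) subspace of the span of the monomials divisible by `e_r`
contains `e_r` as soon as it contains a vector having an inclusion-maximal monomial. -/
theorem eVec_mem_of_maximal {r : HalfPos} {W : Submodule ℂ FSpace}
    (hW : W ≤ divisibleBy r) (hann : ∀ q ≠ r, ∀ v ∈ W, phiAnnih q v ∈ W)
    (n : ℕ) : ∀ (v : FSpace) (s : Finset HalfPos), s.card = n → v ∈ W → v s ≠ 0 →
      (∀ t, v t ≠ 0 → s ⊆ t → t = s) → eVec r ∈ W := by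
  induction n with
  | zero =>
    intro v s hs hv hvs _
    simpa [Finset.card_eq_zero.1 hs] using mem_divisibleBy.1 (hW hv) s hvs
  | succ n ih =>
    intro v s hs hv hvs hmax
    have hrs := mem_divisibleBy.1 (hW hv) s hvs
    by_cases h : ∃ q ∈ s, q ≠ r
    · obtain ⟨q, hq, hqr⟩ := h
      refine ih (phiAnnih q v) (s.erase q) ?_ (hann q hqr v hv) ?_ ?_
      · rw [Finset.card_erase_of_mem hq, hs, Nat.add_sub_cancel]
      · rw [phiAnnih_apply, if_neg (Finset.notMem_erase q s)]
        simpa [Finset.insert_erase hq, zpow_ne_zero] using hvs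
      · intro t ht hst
        rw [phiAnnih_apply] at ht
        split_ifs at ht with hqt
        · exact absurd rfl ht
        · have := hmax _ (right_ne_zero_of_mul ht) (Finset.subset_insert_iff.2 hst)
          rw [← this, Finset.erase_insert hqt]
    · push Not at h
      have hsr : s = {r} := Finset.eq_singleton_iff_unique_mem.2 ⟨hrs, h⟩
      subst hsr
      have hvr : v = v {r} • eVec r := by
        ext t
        by_cases ht : t = {r}
        · simp [ht, eVec, bVec]
        · have : v t = 0 := by
            by_contra hvt
            exact ht (hmax t hvt
              (Finset.singleton_subset_iff.2 (mem_divisibleBy.1 (hW hv) t hvt)))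
          simp [this, eVec, bVec, Ne.symm ht]
      rw [hvr] at hv
      exact (Submodule.smul_mem_iff W hvs).1 hv

theorem eVec_mem_of_ne_bot {r : HalfPos} {W : Submodule ℂ FSpace}
    (hW : W ≤ divisibleBy r) (hann : ∀ q ≠ r, ∀ v ∈ W, phiAnnih q v ∈ W)
    (hne : W ≠ ⊥) : eVec r ∈ W := by
  obtain ⟨v, hv, hv0⟩ := Submodule.exists_mem_ne_zero_of_ne_bot hne
  obtain ⟨s, hs, hmax⟩ := v.support.exists_max_image Finset.card
    (Finsupp.support_nonempty_iff.2 hv0)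
  exact eVec_mem_of_maximal hW hann _ v s rfl hv (Finsupp.mem_support_iff.1 hs)
    fun t ht hst => (Finset.eq_of_subset_of_card_le hst
      (hmax t (Finsupp.mem_support_iff.2 ht))).symm

/-- Example 4.1(3) of the paper.  For `p = 0`, `χ₀ = λ ∈ ½ℤ`,
`λ > ½` (doubled `lam > 1`) and `χ_j = 0` for `j < 0` (so `G(m) = (λ-m-½)Φ(m)`):
the smallest `G`-invariant subspace containing `e_{λ-½} = Φ(-λ+½) 𝟙` is an
irreducible submodule of `F(λ/z)`. -/
theorem genSub_eVec_irreducible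
    (ε c : ℂ) (hε : ε = 1 ∨ ε = -1) (hc : c ^ 2 = -(1 / 2))
    (lam : ℤ) (hlam : 1 < lam) (χ : ℤ → ℂ)
    (hχ0 : χ 0 = (lam : ℂ) / 2) (hχ : ∀ j : ℤ, j < 0 → χ j = 0) :
    ∀ W ≤ genSub ε c 0 χ (eVec ⟨lam - 1, by omega⟩), GInvariant ε c 0 χ W →
      W = ⊥ ∨ W = genSub ε c 0 χ (eVec ⟨lam - 1, by omega⟩) := by
  intro W hWle hW
  have hG (m : ℤ) : Gop ε c 0 χ m = (((lam - 1 - m : ℤ) : ℂ) / 2) • Phi ε c m := by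
    rw [Gop_eq_smul_Phi ε c hχ, hχ0]
    congr 1
    push_cast
    ring
  have hgen : genSub ε c 0 χ (eVec ⟨lam - 1, by omega⟩) ≤
      divisibleBy ⟨lam - 1, by omega⟩ := by
    refine sInf_le ⟨fun m v hv => ?_, bVec_mem_divisibleBy (Finset.mem_singleton_self _)⟩
    rw [hG, LinearMap.smul_apply]
    by_cases hm : m = lam - 1
    · simp [hm]
    · refine Submodule.smul_mem _ _ ?_
      unfold Phi
      split_ifs
      · exact phiAnnih_mem_divisibleBy (fun h => hm (congrArg Subtype.val h)) hv
      · exact phiCreate_mem_divisibleBy _ hv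
      · exact Submodule.smul_mem _ _ hv
  refine or_iff_not_imp_left.2 fun hne => le_antisymm hWle (sInf_le ⟨hW, ?_⟩)
  refine eVec_mem_of_ne_bot (hWle.trans hgen) (fun q hq v hv => ?_) hne
  have hqv := hW q.1 v hv
  have hcoef : ((lam - 1 - q.1 : ℤ) : ℂ) / 2 ≠ 0 := by
    refine div_ne_zero (Int.cast_ne_zero.2 fun h => hq (Subtype.ext ?_)) two_ne_zero
    change q.1 = lam - 1
    omega
  rw [hG, LinearMap.smul_apply, Submodule.smul_mem_iff W hcoef] at hqv
  simpa [Phi, q.2] using hqv
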